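/- Let P be a simple grid polygon with C cells and perimeter E, and let s ∈ P be a cell that is edge-adjacent to some cell outside P. Then there exists a closed walk in P starting and ending at s that covers P and has length at most C + E/2 − 3. -/

import Mathlib

/-- A cell of the integer grid. -/
abbrev Cell : Type := ℤ × ℤ

/-- Two cells are edge-adjacent if they differ by exactly 1 in one coordinate
and 0 in the other. -/
def EdgeAdj (c d : Cell) : Prop :=
  (c.1 - d.1).natAbs + (c.2 - d.2).natAbs = 1

/-- Two cells are touching if they are distinct and differ by at most 1
in each coordinate. -/
def Touching (c d : Cell) : Prop :=
  c ≠ d ∧ (c.1 - d.1).natAbs ≤ 1 ∧ (c.2 - d.2).natAbs ≤ 1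

/-- A set of cells is connected under a relation `R` if any two of its members
are joined by a chain inside the set. -/
def ConnectedUnder (R : Cell → Cell → Prop) (S : Set Cell) : Prop :=
  ∀ c ∈ S, ∀ d ∈ S, Relation.ReflTransGen (fun a b => a ∈ S ∧ b ∈ S ∧ R a b) c d

/-- A grid polygon: a finite nonempty set of cells, connected under edge-adjacency. -/
def GridPolygon (P : Finset Cell) : Prop :=
  P.Nonempty ∧ ConnectedUnder EdgeAdj (↑P : Set Cell)

/-- A simple grid polygon: a grid polygon whose complement is connected under
touching-adjacency (no holes). -/
def SimplePolygon (P : Finset Cell) : Prop :=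
  GridPolygon P ∧ ConnectedUnder Touching ((↑P : Set Cell)ᶜ)

/-- The four edge-neighbors of a cell. -/
def nbrs (c : Cell) : Finset Cell :=
  {(c.1 + 1, c.2), (c.1 - 1, c.2), (c.1, c.2 + 1), (c.1, c.2 - 1)}

/-- The perimeter of a finite set of cells: the number of ordered pairs `(c, d)`
of edge-adjacent cells with `c ∈ S` and `d ∉ S`. -/
def perimeter (S : Finset Cell) : ℕ :=
  ∑ c ∈ S, ((nbrs c).filter (fun d => d ∉ S)).card

/-- `w 0, …, w n` is a walk in `P`: all cells belong to `P` and consecutive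
cells are edge-adjacent. -/
def IsWalk (P : Finset Cell) (w : ℕ → Cell) (n : ℕ) : Prop :=
  (∀ i ≤ n, w i ∈ P) ∧ ∀ i < n, EdgeAdj (w i) (w (i + 1))

/-- The walk `w 0, …, w n` covers `P`: every cell of `P` occurs among the `w i`. -/
def Covers (P : Finset Cell) (w : ℕ → Cell) (n : ℕ) : Prop :=
  ∀ c ∈ P, ∃ i ≤ n, w i = c


def ebH (P : Finset Cell) : Finset Cell := P.filter (fun c => (c.1+1, c.2) ∈ P)
def ebV (P : Finset Cell) : Finset Cell := P.filter (fun c => (c.1, c.2+1) ∈ P)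
def ebB (P : Finset Cell) : Finset Cell :=
  P.filter (fun c => (c.1+1, c.2) ∈ P ∧ (c.1, c.2+1) ∈ P ∧ (c.1+1, c.2+1) ∈ P)

theorem int_const_zero (g : ℤ → ℚ) (h : ∀ y, g y = g (y-1)) (m : ℤ) (hm : g m = 0) (y : ℤ) :
    g y = 0 := by
  induction y using Int.inductionOn' (b := m) with
  | zero => exact hm
  | succ k hk ih => rw [h, add_sub_cancel_right, ih]
  | pred k hk ih => rw [← h, ih]

theorem exists_low (P : Finset Cell) : ∃ m : ℤ, ∀ c ∈ P, m < c.2 := by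
  obtain ⟨m, hm⟩ := (P.image Prod.snd).bddBelow
  refine ⟨m - 1, fun c hc => ?_⟩
  have := hm (Finset.mem_coe.2 (Finset.mem_image_of_mem Prod.snd hc))
  linarith

/-- column sums -/
def colsum (H : Finset Cell) (f : Cell → ℚ) (c : Cell) : ℚ :=
  ∑ e ∈ H.filter (fun e => e.1 = c.1 ∧ e.2 ≤ c.2), f e

theorem colsum_sub (H : Finset Cell) (f : Cell → ℚ) (hf : ∀ c ∉ H, f c = 0) (x y : ℤ) :
    colsum H f (x, y) - colsum H f (x, y-1) = f (x, y) := by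
  unfold colsum
  by_cases h : (x, y) ∈ H
  · have : H.filter (fun e => e.1 = x ∧ e.2 ≤ y) =
        insert (x, y) (H.filter (fun e => e.1 = x ∧ e.2 ≤ y - 1)) := by
      ext ⟨a, b⟩
      simp only [Finset.mem_filter, Finset.mem_insert, Prod.mk.injEq]
      constructor
      · rintro ⟨h1, h2, h3⟩
        by_cases hb : b = y
        · left; exact ⟨h2, hb⟩
        · right; exact ⟨h1, h2, by omega⟩
      · rintro (⟨rfl, rfl⟩ | ⟨h1, h2, h3⟩)
        · exact ⟨h, rfl, le_rfl⟩
        · exact ⟨h1, h2, by omega⟩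
    simp only [this]
    rw [Finset.sum_insert (by simp)]
    ring
  · have : H.filter (fun e => e.1 = x ∧ e.2 ≤ y) =
        (H.filter (fun e => e.1 = x ∧ e.2 ≤ y - 1)) := by
      ext ⟨a, b⟩
      simp only [Finset.mem_filter]
      constructor
      · rintro ⟨h1, h2, h3⟩
        refine ⟨h1, h2, ?_⟩
        by_contra hb
        have : b = y := by omega
        subst this; subst h2; exact h h1
      · rintro ⟨h1, h2, h3⟩
        exact ⟨h1, h2, by omega⟩
    simp only [this, hf _ h, sub_self]

/-- the core vanishing statement -/
theorem cycle_zero (P : Finset Cell) (hc : ConnectedUnder Touching ((↑P : Set Cell)ᶜ))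
    (p0 : Cell) (h v : Cell → ℚ) (hh : ∀ c ∉ ebH P, h c = 0) (hv : ∀ c ∉ ebV P, v c = 0)
    (hdiv : ∀ c ∈ P, c ≠ p0 → h c - h (c.1-1, c.2) + v c - v (c.1, c.2-1) = 0)
    (hb : ∀ c ∈ ebB P, colsum (ebH P) h c = 0) : (∀ c, h c = 0) ∧ (∀ c, v c = 0) := by
  have h0 : ∀ x y, (x, y) ∉ P → h (x, y) = 0 ∧ h (x-1, y) = 0 ∧ v (x, y) = 0 ∧ v (x, y-1) = 0 := by
    intro x y hx
    refine ⟨hh _ ?_, hh _ ?_, hv _ ?_, hv _ ?_⟩ <;> simp [ebH, ebV, hx]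
  have hdiv1 : ∀ c, c ≠ p0 → h c - h (c.1-1, c.2) + v c - v (c.1, c.2-1) = 0 := by
    intro c hcp
    by_cases hcP : c ∈ P
    · exact hdiv c hcP hcp
    · obtain ⟨a1, a2, a3, a4⟩ := h0 c.1 c.2 hcP
      simp only [Prod.mk.eta] at a1 a3
      rw [a1, a2, a3, a4]; ring
  have fh : h.support.Finite := (ebH P).finite_toSet.subset (fun c hc => by
    by_contra hn; exact hc (hh c hn))
  have fv : v.support.Finite := (ebV P).finite_toSet.subset (fun c hc => by
    by_contra hn; exact hc (hv c hn))
  let e1 : Cell ≃ Cell := (Equiv.subRight (1:ℤ)).prodCongr (Equiv.refl ℤ)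
  let e2 : Cell ≃ Cell := (Equiv.refl ℤ).prodCongr (Equiv.subRight (1:ℤ))
  have s1 : ∑ᶠ c : Cell, h (c.1-1, c.2) = ∑ᶠ c, h c := finsum_comp_equiv (f := h) e1
  have s2 : ∑ᶠ c : Cell, v (c.1, c.2-1) = ∑ᶠ c, v c := finsum_comp_equiv (f := v) e2
  have fh1 : (fun c : Cell => h (c.1-1, c.2)).support.Finite := by
    exact fh.preimage (f := e1) e1.injective.injOn
  have fv1 : (fun c : Cell => v (c.1, c.2-1)).support.Finite := by
    exact fv.preimage (f := e2) e2.injective.injOn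
  have key : ∑ᶠ c : Cell, ((h c - h (c.1-1, c.2)) + (v c - v (c.1, c.2-1))) = 0 := by
    rw [finsum_add_distrib, finsum_sub_distrib fh fh1, finsum_sub_distrib fv fv1, s1, s2]
    · ring
    · exact (fh.union fh1).subset (Function.support_sub _ _)
    · exact (fv.union fv1).subset (Function.support_sub _ _)
  have hdiv2 : ∀ c, h c - h (c.1-1, c.2) + v c - v (c.1, c.2-1) = 0 := by
    intro c
    by_cases hcp : c = p0
    · subst hcp
      rw [finsum_eq_single _ c] at key
      · linarith
      · intro x hx; have := hdiv1 x hx; linarith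
    · exact hdiv1 c hcp
  obtain ⟨m, hm⟩ := exists_low P
  set b := colsum (ebH P) h with hbdef
  have blow : ∀ x y, y ≤ m → b (x, y) = 0 := by
    intro x y hy
    rw [hbdef]; unfold colsum
    apply Finset.sum_eq_zero
    intro e he
    simp only [ebH, Finset.mem_filter] at he
    have := hm e he.1.1
    omega
  have bh : ∀ x y, b (x, y) - b (x, y-1) = h (x, y) := colsum_sub _ _ hh
  have bv : ∀ x y, b (x-1, y) - b (x, y) = v (x, y) := by
    intro x y
    have := int_const_zero (fun y => b (x-1, y) - b (x, y) - v (x, y)) (by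
      intro y
      have h1 := bh x y
      have h2 := bh (x-1) y
      have h3 := hdiv2 (x, y)
      simp only at h3 ⊢
      linarith) m (by
      have : v (x, m) = 0 := hv _ (by
        simp only [ebV, Finset.mem_filter, not_and]
        intro hc; have := hm _ hc; simp at this)
      simp only [this, blow _ _ le_rfl]; ring) y
    linarith
  have b0 : ∀ x y, (x, y) ∉ P → b (x-1, y) = b (x, y) ∧ b (x, y-1) = b (x, y) ∧
      b (x-1, y-1) = b (x, y) := by
    intro x y hx
    obtain ⟨a1, a2, a3, a4⟩ := h0 x y hx
    have := bh x y
    have := bh (x-1) y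
    have := bv x y
    refine ⟨?_, ?_, ?_⟩ <;> linarith
  have btouch : ∀ c d : Cell, c ∉ P → d ∉ P → Touching c d → b c = b d := by
    rintro ⟨x, y⟩ ⟨x', y'⟩ hc hd ⟨-, t1, t2⟩
    simp only at t1 t2
    have hx : x' = x - 1 ∨ x' = x ∨ x' = x + 1 := by omega
    have hy : y' = y - 1 ∨ y' = y ∨ y' = y + 1 := by omega
    obtain ⟨c1, c2, c3⟩ := b0 _ _ hc
    obtain ⟨d1, d2, d3⟩ := b0 _ _ hd
    rcases hx with rfl | rfl | rfl <;> rcases hy with rfl | rfl | rfl <;>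
      (try simp only [add_sub_cancel_right] at d1 d2 d3) <;> linarith
  have bout : ∀ c, c ∉ P → b c = 0 := by
    intro c hcP
    have hm0 : ((0, m) : Cell) ∉ P := fun hc => by have := hm _ hc; simp at this
    have hr := hc c (by simpa using hcP) (0, m) (by simpa using hm0)
    have : b c = b (0, m) := by
      generalize ((0, m) : Cell) = z at hr
      induction hr with
      | refl => rfl
      | tail _ hab ih => rw [ih]; exact btouch _ _ (by simpa using hab.1) (by simpa using hab.2.1) hab.2.2
    rw [this, blow _ _ le_rfl]
  have ball : ∀ x y, b (x, y) = 0 := by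
    intro x y
    by_cases h1 : (x, y) ∈ P
    swap
    · exact bout _ h1
    by_cases h2 : (x+1, y) ∈ P
    swap
    · have := (b0 _ _ h2).1; rw [bout _ h2] at this; simpa using this
    by_cases h3 : (x, y+1) ∈ P
    swap
    · have := (b0 _ _ h3).2.1; rw [bout _ h3] at this; simpa using this
    by_cases h4 : (x+1, y+1) ∈ P
    swap
    · have := (b0 _ _ h4).2.2; rw [bout _ h4] at this; simpa using this
    exact hb _ (by simp [ebB, h1, h2, h3, h4])
  constructor
  · rintro ⟨x, y⟩; rw [← bh, ball, ball]; ring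
  · rintro ⟨x, y⟩; rw [← bv, ball, ball]; ring

def exz (H : Finset Cell) : (H → ℚ) →ₗ[ℚ] (Cell → ℚ) where
  toFun f c := if hc : c ∈ H then f ⟨c, hc⟩ else 0
  map_add' f g := by ext c; by_cases hc : c ∈ H <;> simp [hc]
  map_smul' a f := by ext c; by_cases hc : c ∈ H <;> simp [hc]

theorem exz_off (H : Finset Cell) (f : H → ℚ) (c : Cell) (hc : c ∉ H) : exz H f c = 0 := by
  simp [exz, hc]

theorem exz_zero (H : Finset Cell) (f : H → ℚ) (h : ∀ c, exz H f c = 0) : f = 0 := by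
  ext ⟨c, hc⟩
  have := h c
  simpa [exz, hc] using this

def eulerMap (P : Finset Cell) (p0 : Cell) :
    ((ebH P → ℚ) × (ebV P → ℚ)) →ₗ[ℚ] ((P.erase p0 → ℚ) × (ebB P → ℚ)) where
  toFun f := (fun c => exz _ f.1 c - exz _ f.1 (c.1.1-1, c.1.2) + exz _ f.2 c
      - exz _ f.2 (c.1.1, c.1.2-1), fun c => colsum (ebH P) (exz _ f.1) c)
  map_add' f g := by
    ext c
    · simp; ring
    · simp [colsum, Finset.sum_add_distrib]
  map_smul' a f := by
    ext c
    · simp; ring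
    · simp [colsum, Finset.mul_sum]

theorem euler_ineq (P : Finset Cell) (hc : ConnectedUnder Touching ((↑P : Set Cell)ᶜ))
    (p0 : Cell) (hp : p0 ∈ P) : (ebH P).card + (ebV P).card + 1 ≤ P.card + (ebB P).card := by
  have inj : Function.Injective (eulerMap P p0) := by
    rw [injective_iff_map_eq_zero]
    rintro ⟨h, v⟩ hf
    simp only [eulerMap, LinearMap.coe_mk, AddHom.coe_mk, Prod.mk_eq_zero] at hf
    obtain ⟨f1, f2⟩ := hf
    have := cycle_zero P hc p0 (exz _ h) (exz _ v) (exz_off _ _) (exz_off _ _)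
      (fun c hcP hne => congrFun f1 ⟨c, Finset.mem_erase.2 ⟨hne, hcP⟩⟩)
      (fun c hcB => congrFun f2 ⟨c, hcB⟩)
    rw [exz_zero _ _ this.1, exz_zero _ _ this.2]
    rfl
  have := LinearMap.finrank_le_finrank_of_injective inj
  simp only [Module.finrank_prod, Module.finrank_fintype_fun_eq_card, Fintype.card_coe] at this
  rw [Finset.card_erase_of_mem hp] at this
  have : 0 < P.card := Finset.card_pos.2 ⟨p0, hp⟩
  omega

theorem perimeter_eq (P : Finset Cell) :
    perimeter P + 2 * (ebH P).card + 2 * (ebV P).card = 4 * P.card := by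
  have hH : (P.filter (fun c => (c.1-1, c.2) ∈ P)).card = (ebH P).card := by
    apply Finset.card_bij' (fun c _ => (c.1-1, c.2)) (fun c _ => (c.1+1, c.2)) <;>
      simp +contextual [ebH]
  have hV : (P.filter (fun c => (c.1, c.2-1) ∈ P)).card = (ebV P).card := by
    apply Finset.card_bij' (fun c _ => (c.1, c.2-1)) (fun c _ => (c.1, c.2+1)) <;>
      simp +contextual [ebV]
  have h1 : perimeter P + ((ebH P).card + (P.filter (fun c => (c.1-1, c.2) ∈ P)).card +
      (ebV P).card + (P.filter (fun c => (c.1, c.2-1) ∈ P)).card) = ∑ c ∈ P, 4 := by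
    unfold perimeter ebH ebV
    simp only [Finset.card_filter]
    rw [← Finset.sum_add_distrib, ← Finset.sum_add_distrib, ← Finset.sum_add_distrib,
      ← Finset.sum_add_distrib]
    apply Finset.sum_congr rfl
    rintro ⟨x, y⟩ -
    unfold nbrs
    rw [Finset.sum_insert, Finset.sum_insert, Finset.sum_insert, Finset.sum_singleton]
    · split_ifs <;> rfl
    all_goals simp
    all_goals omega
  rw [hH, hV, Finset.sum_const, smul_eq_mul] at h1
  omega

theorem EdgeAdj.symm' {c d : Cell} (h : EdgeAdj c d) : EdgeAdj d c := by
  unfold EdgeAdj at *; omega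

def gridG : SimpleGraph Cell where
  Adj := EdgeAdj
  symm := ⟨fun _ _ h => h.symm'⟩
  loopless := ⟨fun c h => by simp [EdgeAdj] at h⟩

def Tour (S : Finset Cell) (n : ℕ) : Prop :=
  ∃ c, ∃ p : gridG.Walk c c, (∀ v, v ∈ p.support ↔ v ∈ S) ∧ p.length = n

theorem Tour.at {S : Finset Cell} {n : ℕ} (h : Tour S n) (c : Cell) (hc : c ∈ S) :
    ∃ p : gridG.Walk c c, (∀ v, v ∈ p.support ↔ v ∈ S) ∧ p.length = n := by
  obtain ⟨d, p, hp, hn⟩ := h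
  exact ⟨p.rotate c ((hp c).2 hc), by simpa using hp, by simpa using hn⟩

theorem Tour.merge {S D : Finset Cell} {n m : ℕ} (h : Tour S n) (h' : Tour D m) (c d : Cell)
    (hc : c ∈ S) (hd : d ∈ D) (hcd : EdgeAdj c d) : Tour (S ∪ D) (n + m + 2) := by
  obtain ⟨p, hp, hn⟩ := h.at c hc
  obtain ⟨q, hq, hm⟩ := h'.at d hd
  have a1 : gridG.Adj c d := hcd
  refine ⟨c, p.append (.cons a1 (q.append (.cons a1.symm .nil))), ?_, ?_⟩
  · intro v
    simp only [SimpleGraph.Walk.mem_support_append_iff, SimpleGraph.Walk.support_cons,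
      List.mem_cons, SimpleGraph.Walk.support_nil, hp, hq, Finset.mem_union, List.not_mem_nil]
    constructor
    · rintro (h | rfl | h | rfl | rfl | h) <;> tauto
    · tauto
  · simp only [SimpleGraph.Walk.length_append, SimpleGraph.Walk.length_cons,
      SimpleGraph.Walk.length_nil]
    omega

theorem tour_single (d : Cell) : Tour {d} 0 := ⟨d, .nil, by simp, by simp⟩

theorem hline (y a : ℤ) (k : ℕ) : ∃ p : gridG.Walk (a, y) (a + k, y),
    (∀ v, v ∈ p.support ↔ v.2 = y ∧ a ≤ v.1 ∧ v.1 ≤ a + k) ∧ p.length = k := by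
  induction k with
  | zero =>
    refine ⟨(SimpleGraph.Walk.nil : gridG.Walk (a, y) (a, y)).copy rfl (by simp), ?_, by simp⟩
    rintro ⟨u, v⟩
    simp only [SimpleGraph.Walk.support_copy, SimpleGraph.Walk.support_nil, List.mem_singleton,
      Prod.mk.injEq, Nat.cast_zero]
    omega
  | succ k ih =>
    obtain ⟨p, hp, hl⟩ := ih
    have adj : gridG.Adj (a + k, y) (a + (k + 1 : ℕ), y) := by
      change EdgeAdj _ _
      unfold EdgeAdj; push_cast; simp
    refine ⟨p.concat adj, ?_, by simp [hl]⟩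
    rintro ⟨u, v⟩
    rw [SimpleGraph.Walk.support_concat]
    simp only [List.mem_append, hp, List.mem_singleton, Prod.mk.injEq]
    push_cast
    omega

noncomputable def rect (y a : ℤ) (k : ℕ) : Finset Cell := Finset.Icc a (a + k) ×ˢ {y, y + 1}

theorem mem_rect (y a : ℤ) (k : ℕ) (u v : ℤ) :
    (u, v) ∈ rect y a k ↔ (a ≤ u ∧ u ≤ a + k) ∧ (v = y ∨ v = y + 1) := by
  simp [rect]

theorem tour_rect (y a : ℤ) (k : ℕ) : Tour (rect y a k) (2 * (k + 1)) := by
  obtain ⟨p, hp, hl⟩ := hline y a k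
  obtain ⟨q, hq, hm⟩ := hline (y+1) a k
  have a1 : gridG.Adj (a + k, y) (a + k, y + 1) := by
    change EdgeAdj _ _
    simp [EdgeAdj]
  have a2 : gridG.Adj (a, y + 1) (a, y) := by
    change EdgeAdj _ _
    simp [EdgeAdj]
  refine ⟨_, p.append (.cons a1 (q.reverse.append (.cons a2 .nil))), ?_, ?_⟩
  · rintro ⟨u, v⟩
    simp only [SimpleGraph.Walk.mem_support_append_iff, SimpleGraph.Walk.support_cons,
      List.mem_cons, SimpleGraph.Walk.support_nil, hp, hq, List.not_mem_nil,
      SimpleGraph.Walk.support_reverse, List.mem_reverse, mem_rect, Prod.mk.injEq, or_false]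
    omega
  · simp only [SimpleGraph.Walk.length_append, SimpleGraph.Walk.length_cons,
      SimpleGraph.Walk.length_nil, SimpleGraph.Walk.length_reverse]
    omega

def fullcol (P : Finset Cell) (x y : ℤ) : Prop := (x, y) ∈ P ∧ (x, y+1) ∈ P

def Sat (P : Finset Cell) (r : ℤ) (S : Finset Cell) : Prop :=
  ∀ x y, (y - r) % 2 = 0 → fullcol P x y → ((x, y) ∈ S ↔ (x, y+1) ∈ S) ∧
    (fullcol P (x+1) y → ((x, y) ∈ S ↔ (x+1, y) ∈ S))

def blk (r : ℤ) (S : Finset Cell) : Finset Cell := (ebB S).filter (fun c => (c.2 - r) % 2 = 0)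

theorem mem_blk (r : ℤ) (S : Finset Cell) (x y : ℤ) : (x, y) ∈ blk r S ↔
    ((x, y) ∈ S ∧ (x+1, y) ∈ S ∧ (x, y+1) ∈ S ∧ (x+1, y+1) ∈ S) ∧ (y - r) % 2 = 0 := by
  simp [blk, ebB]

theorem exists_left (Q : ℤ → Prop) (m x : ℤ) (hm : ∀ t, Q t → m ≤ t) (hx : Q x) :
    ∃ a ≤ x, (∀ t, a ≤ t → t ≤ x → Q t) ∧ ¬ Q (a-1) := by
  obtain ⟨a, ⟨h1, h2⟩, h3⟩ := Int.exists_least_of_bdd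
    (P := fun a => a ≤ x ∧ ∀ t, a ≤ t → t ≤ x → Q t)
    ⟨m, fun z hz => hm z (hz.2 z le_rfl hz.1)⟩
    ⟨x, le_rfl, fun t h1 h2 => by rwa [le_antisymm h2 h1]⟩
  refine ⟨a, h1, h2, fun hq => ?_⟩
  have := h3 (a-1) ⟨by omega, fun t ht1 ht2 => by
    by_cases h : t = a - 1
    · rwa [h]
    · exact h2 t (by omega) ht2⟩
  omega

theorem cluster (P : Finset Cell) (r : ℤ) (d : Cell) (hd : d ∈ P) :
    ∃ D ⊆ P, d ∈ D ∧ Sat P r D ∧ (∀ S, Sat P r S → ∀ v ∈ D, (v ∈ S ↔ d ∈ S)) ∧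
      ∃ n, Tour D n ∧ n + 2 + 2 * (blk r D).card ≤ 2 * D.card := by
  obtain ⟨x, y⟩ := d
  obtain ⟨y0, hy0, hpar⟩ : ∃ y0, (y = y0 ∨ y = y0 + 1) ∧ (y0 - r) % 2 = 0 := by
    by_cases h : (y - r) % 2 = 0
    · exact ⟨y, by simp, h⟩
    · exact ⟨y - 1, by omega, by omega⟩
  by_cases hf : fullcol P x y0
  · obtain ⟨m, hm⟩ := (P.image Prod.fst).bddBelow
    obtain ⟨m', hm'⟩ := (P.image Prod.fst).bddAbove
    have hm1 : ∀ t, fullcol P t y0 → m ≤ t := fun t ht =>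
      hm (Finset.mem_coe.2 (Finset.mem_image_of_mem Prod.fst ht.1))
    have hm2 : ∀ t, fullcol P t y0 → t ≤ m' := fun t ht =>
      hm' (Finset.mem_coe.2 (Finset.mem_image_of_mem Prod.fst ht.1))
    obtain ⟨a, ha, ha1, ha2⟩ := exists_left (fun t => fullcol P t y0) m x hm1 hf
    obtain ⟨b', hb, hb1, hb2⟩ := exists_left (fun t => fullcol P (-t) y0) (-m') (-x)
      (fun t ht => by have := hm2 _ ht; omega) (by simpa using hf)
    obtain ⟨k, hk⟩ : ∃ k : ℕ, -b' = a + k := ⟨(-b' - a).toNat, by omega⟩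
    have full : ∀ t, a ≤ t → t ≤ a + k → fullcol P t y0 := by
      intro t h1 h2
      by_cases h : t ≤ x
      · exact ha1 t h1 h
      · have := hb1 (-t) (by omega) (by omega)
        simpa using this
    have nb : ¬ fullcol P (a + k + 1) y0 := by
      have : -(b' - 1) = a + k + 1 := by omega
      rwa [this] at hb2
    have hdD : (x, y) ∈ rect y0 a k := by rw [mem_rect]; omega
    refine ⟨rect y0 a k, ?_, hdD, ?_, ?_, 2 * (k+1), tour_rect _ _ _, ?_⟩
    · rintro ⟨u, v⟩ huv
      rw [mem_rect] at huv
      have := full u huv.1.1 huv.1.2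
      rcases huv.2 with rfl | rfl
      · exact this.1
      · exact this.2
    · intro u v hpv hfu
      simp only [mem_rect]
      refine ⟨by omega, fun hfu1 => ?_⟩
      by_cases hv : v = y0
      · subst hv
        have h1 : u ≠ a + k := by rintro rfl; exact nb hfu1
        have h2 : u ≠ a - 1 := by rintro rfl; exact ha2 hfu
        omega
      · omega
    · intro S hS
      have row : ∀ j : ℕ, j ≤ k → ((a + j, y0) ∈ S ↔ (a, y0) ∈ S) := by
        intro j
        induction j with
        | zero => simp
        | succ j ih =>
          intro hj
          rw [← ih (by omega)]
          have f1 := full (a + j) (by omega) (by omega)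
          have f2 := full (a + j + 1) (by omega) (by omega)
          have := (hS _ _ hpar f1).2 f2
          rw [this]; push_cast; rw [add_assoc]
      have all : ∀ v ∈ rect y0 a k, (v ∈ S ↔ (a, y0) ∈ S) := by
        rintro ⟨u, v⟩ huv
        rw [mem_rect] at huv
        obtain ⟨j, hj⟩ : ∃ j : ℕ, u = a + j := ⟨(u - a).toNat, by omega⟩
        have h1 := row j (by omega)
        rw [← hj] at h1
        have h2 := (hS _ _ hpar (full u huv.1.1 huv.1.2)).1
        rcases huv.2 with rfl | rfl
        · exact h1
        · rw [← h2, h1]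
      intro v hv
      rw [all v hv, all _ hdD]
    · have hcard : (rect y0 a k).card = (k + 1) * 2 := by
        unfold rect
        rw [Finset.card_product, Finset.card_pair (by omega), Int.card_Icc]
        congr 1
        omega
      have hsub : blk r (rect y0 a k) ⊆ Finset.Ico a (a + k) ×ˢ {y0} := by
        rintro ⟨u, v⟩ huv
        simp only [mem_blk, mem_rect] at huv
        simp only [Finset.mem_product, Finset.mem_Ico, Finset.mem_singleton]
        omega
      have := Finset.card_le_card hsub
      rw [Finset.card_product, Int.card_Ico, Finset.card_singleton] at this
      omega
  · refine ⟨{(x, y)}, by simpa using hd, by simp, ?_, ?_, 0, tour_single _, ?_⟩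
    · intro u v hpv hfu
      have key : ¬ (u = x ∧ v = y0) := by rintro ⟨rfl, rfl⟩; exact hf hfu
      have key2 : fullcol P (u+1) v → ¬ (u + 1 = x ∧ v = y0) := by
        rintro h ⟨rfl, rfl⟩; exact hf h
      simp only [Finset.mem_singleton, Prod.mk.injEq]
      refine ⟨by omega, fun h => ?_⟩
      have := key2 h
      omega
    · intro S hS v hv
      rw [Finset.mem_singleton.1 hv]
    · have : blk r {(x, y)} = ∅ := by
        ext ⟨u, v⟩
        simp only [mem_blk, Finset.mem_singleton, Prod.mk.injEq, Finset.notMem_empty, iff_false]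
        omega
      simp [this]

theorem blk_union (P : Finset Cell) (r : ℤ) (S D : Finset Cell) (hSP : S ⊆ P) (hDP : D ⊆ P)
    (hS : Sat P r S) (hD : Sat P r D) : blk r (S ∪ D) ⊆ blk r S ∪ blk r D := by
  rintro ⟨x, y⟩ h
  have hP : S ∪ D ⊆ P := Finset.union_subset hSP hDP
  rw [Finset.mem_union]
  simp only [mem_blk] at h ⊢
  obtain ⟨⟨h1, h2, h3, h4⟩, hp⟩ := h
  have f1 : fullcol P x y := ⟨hP h1, hP h3⟩
  have f2 : fullcol P (x+1) y := ⟨hP h2, hP h4⟩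
  have s1 := hS _ _ hp f1
  have s2 := hS _ _ hp f2
  have s3 := hD _ _ hp f1
  have s4 := hD _ _ hp f2
  have s5 := s1.2 f2
  have s6 := s3.2 f2
  rcases Finset.mem_union.1 h1 with h | h
  · exact Or.inl ⟨⟨h, s5.1 h, s1.1.1 h, s2.1.1 (s5.1 h)⟩, hp⟩
  · exact Or.inr ⟨⟨h, s6.1 h, s3.1.1 h, s4.1.1 (s6.1 h)⟩, hp⟩

theorem exists_exit (P S : Finset Cell) (hP : ConnectedUnder EdgeAdj (↑P : Set Cell))
    (hSP : S ⊆ P) (s t : Cell) (hs : s ∈ S) (ht : t ∈ P) (htS : t ∉ S) :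
    ∃ c ∈ S, ∃ d ∈ P, d ∉ S ∧ EdgeAdj c d := by
  by_contra hcon
  push Not at hcon
  have hr := hP s (hSP hs) t ht
  apply htS
  clear htS ht
  induction hr with
  | refl => exact hs
  | tail _ hab ih =>
    by_contra hn
    exact hcon _ ih _ (by simpa using hab.2.1) hn hab.2.2

theorem tour_all (P : Finset Cell) (r : ℤ) (hP : ConnectedUnder EdgeAdj (↑P : Set Cell))
    (k : ℕ) : ∀ (S : Finset Cell) (n : ℕ), P.card - S.card ≤ k → S ⊆ P → S.Nonempty → Sat P r S →
      Tour S n → n + 2 + 2 * (blk r S).card ≤ 2 * S.card →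
      ∃ n, Tour P n ∧ n + 2 + 2 * (blk r P).card ≤ 2 * P.card := by
  induction k with
  | zero =>
    intro S n hk hSP _ _ hT hn
    have : S = P := Finset.eq_of_subset_of_card_le hSP (by omega)
    subst this
    exact ⟨n, hT, hn⟩
  | succ k ih =>
    intro S n hk hSP hne hSat hT hn
    by_cases hall : P ⊆ S
    · have : S = P := Finset.Subset.antisymm hSP hall
      subst this
      exact ⟨n, hT, hn⟩
    obtain ⟨t, ht, htS⟩ := Finset.not_subset.1 hall
    obtain ⟨s, hs⟩ := hne
    obtain ⟨c, hc, d, hd, hdS, hcd⟩ := exists_exit P S hP hSP s t hs ht htS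
    obtain ⟨D, hDP, hdD, hDsat, hDall, m, hTD, hm⟩ := cluster P r d hd
    have hdis : Disjoint S D := by
      rw [Finset.disjoint_left]
      intro v hvS hvD
      exact hdS ((hDall S hSat v hvD).1 hvS)
    have hcard := Finset.card_union_of_disjoint hdis
    have hDpos : 0 < D.card := Finset.card_pos.2 ⟨d, hdD⟩
    have hb := (Finset.card_le_card (blk_union P r S D hSP hDP hSat hDsat)).trans
      (Finset.card_union_le _ _)
    refine ih (S ∪ D) (n + m + 2) (by omega) (Finset.union_subset hSP hDP) ⟨s, by simp [hs]⟩ ?_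
      (hT.merge hTD c d hc hdD hcd) (by omega)
    intro x y hp hf
    have h1 := hSat x y hp hf
    have h2 := hDsat x y hp hf
    simp only [Finset.mem_union]
    refine ⟨by rw [h1.1, h2.1], fun h => by rw [h1.2 h, h2.2 h]⟩

theorem tour_exists (P : Finset Cell) (r : ℤ) (hP : GridPolygon P) :
    ∃ n, Tour P n ∧ n + 2 + 2 * (blk r P).card ≤ 2 * P.card := by
  obtain ⟨⟨s, hs⟩, hc⟩ := hP
  obtain ⟨D, hDP, hdD, hDsat, hDall, m, hTD, hm⟩ := cluster P r s hs
  exact tour_all P r hc _ D m le_rfl hDP ⟨s, hdD⟩ hDsat hTD hm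

theorem blk_card (P : Finset Cell) : (ebB P).card = (blk 0 P).card + (blk 1 P).card := by
  rw [← Finset.card_filter_add_card_filter_not (s := ebB P) (fun c => (c.2 - 0) % 2 = 0)]
  unfold blk
  congr 2
  ext c
  simp only [Finset.mem_filter]
  constructor
  · rintro ⟨h1, h2⟩; exact ⟨h1, by omega⟩
  · rintro ⟨h1, h2⟩; exact ⟨h1, by omega⟩

/-- a simple grid polygon with `C` cells and perimeter `E`,
with start cell `s` edge-adjacent to a cell outside, admits a closed covering
walk from `s` of length at most `C + E/2 - 3`. -/
theorem smartdfs_upper_bound (P : Finset Cell) (hP : SimplePolygon P)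
    (s : Cell) (hs : s ∈ P) (hb : ∃ d, d ∉ P ∧ EdgeAdj s d) :
    ∃ (w : ℕ → Cell) (n : ℕ), w 0 = s ∧ IsWalk P w n ∧ w n = s ∧ Covers P w n ∧
      (n : ℝ) ≤ (P.card : ℝ) + (perimeter P : ℝ) / 2 - 3 := by
  obtain ⟨n, hT, hn⟩ : ∃ n, Tour P n ∧ n + 2 + (ebB P).card ≤ 2 * P.card := by
    obtain ⟨n, hT, hn⟩ := tour_exists P 0 hP.1
    obtain ⟨m, hT', hm⟩ := tour_exists P 1 hP.1
    have := blk_card P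
    by_cases h : (blk 1 P).card ≤ (blk 0 P).card
    · exact ⟨n, hT, by omega⟩
    · exact ⟨m, hT', by omega⟩
  obtain ⟨p, hp, hl⟩ := hT.at s hs
  refine ⟨p.getVert, n, p.getVert_zero, ⟨fun i _ => ?_, fun i hi => ?_⟩, ?_, fun c hc => ?_, ?_⟩
  · exact (hp _).1 (p.getVert_mem_support i)
  · exact p.adj_getVert_succ (by omega)
  · rw [← hl]; exact p.getVert_length
  · obtain ⟨i, h1, h2⟩ := SimpleGraph.Walk.mem_support_iff_exists_getVert.1 ((hp c).2 hc)
    exact ⟨i, by omega, h1⟩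
  · have h1 := euler_ineq P hP.2 s hs
    have h2 := perimeter_eq P
    have h3 : 2 * n + 6 ≤ 2 * P.card + perimeter P := by omega
    have h4 : 2 * (n : ℝ) + 6 ≤ 2 * (P.card : ℝ) + (perimeter P : ℝ) := by exact_mod_cast h3
    linarith
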